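/- arXiv:1409.5932 — 5 statements merged into one kernel-verified Lean document; each statement's English description precedes it below -/
import Mathlib

section
/- Let σ > 0 be real, let A ∈ Matrix (Fin n) (Fin n) ℂ be Hermitian positive definite, and let G, U ∈ Matrix (Fin m) (Fin n) ℂ and Matrix (Fin m) (Fin m) ℂ respectively, i.e. G ∈ Matrix (Fin n) (Fin m) ℂ and U ∈ Matrix (Fin m) (Fin m) ℂ. Define f : Matrix (Fin m) (Fin n) ℂ → ℝ by f(W) = (tr(W·A·W^H) − σ²·tr(U·G^H·W^H) − σ²·tr(W·G·U^H) + σ²·tr(U·U^H)).re, and set W* := σ² · U · G^H · A⁻¹. Then for every W, f(W) − f(W*) = (tr((W−W*)·A·(W−W*)^H)).re ≥ 0; in particular W* minimizes f, and f(W) = f(W*) only if W = W*. -/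
open Matrix
open scoped ComplexOrder

theorem Matrix.PosDef.eq_zero_of_trace_mul_mul_conjTranspose_eq_zero {m n : Type*}
    [Fintype m] [Fintype n] {A : Matrix n n ℂ} (hA : A.PosDef) {V : Matrix m n ℂ}
    (h : (V * A * Vᴴ).trace = 0) : V = 0 := by
  have hV : V * A * Vᴴ = 0 := (hA.posSemidef.mul_mul_conjTranspose_same V).trace_eq_zero_iff.mp h
  have hrow (i : m) : star (V i) = 0 := by
    by_contra hi
    refine (hA.dotProduct_mulVec_pos hi).ne' ?_
    have hii : (V * A * Vᴴ) i i = 0 := by rw [hV, zero_apply]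
    rw [Matrix.mul_assoc] at hii
    rw [star_star]
    exact hii
  ext i j
  exact congrFun (star_eq_zero.mp (hrow i)) j

/-- Eq. (21) of the paper: the linear MMSE receiver
`W* = σ² • U * Gᴴ * A⁻¹` is the unique minimizer of the quadratic MSE functional
`f(W) = re(tr(W A Wᴴ) − σ² tr(U Gᴴ Wᴴ) − σ² tr(W G Uᴴ) + σ² tr(U Uᴴ))`,
with `f(W) − f(W*) = re tr((W − W*) A (W − W*)ᴴ) ≥ 0`. -/
theorem mmse_receiver_optimal
    {m n : ℕ} (σ : ℝ) (hσ : 0 < σ)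
    (A : Matrix (Fin n) (Fin n) ℂ) (hA : A.PosDef)
    (G : Matrix (Fin n) (Fin m) ℂ) (U : Matrix (Fin m) (Fin m) ℂ)
    (f : Matrix (Fin m) (Fin n) ℂ → ℝ)
    (hf : ∀ W, f W =
      ((W * A * Wᴴ).trace - (σ : ℂ) ^ 2 * (U * Gᴴ * Wᴴ).trace
        - (σ : ℂ) ^ 2 * (W * G * Uᴴ).trace + (σ : ℂ) ^ 2 * (U * Uᴴ).trace).re)
    (Wstar : Matrix (Fin m) (Fin n) ℂ)
    (hWstar : Wstar = ((σ : ℂ) ^ 2) • (U * Gᴴ * A⁻¹)) :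
    ∀ W : Matrix (Fin m) (Fin n) ℂ,
      f W - f Wstar = ((W - Wstar) * A * (W - Wstar)ᴴ).trace.re ∧
      0 ≤ ((W - Wstar) * A * (W - Wstar)ᴴ).trace.re ∧
      f Wstar ≤ f W ∧
      (f W = f Wstar → W = Wstar) := by
  have hBA : Wstar * A = (σ : ℂ) ^ 2 • (U * Gᴴ) := by
    rw [hWstar, smul_mul, nonsing_inv_mul_cancel_right _ _ ((isUnit_iff_isUnit_det A).mp hA.isUnit)]
  have hAB : A * Wstarᴴ = (σ : ℂ) ^ 2 • (G * Uᴴ) := by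
    have h := congrArg conjTranspose hBA
    simpa [conjTranspose_mul, conjTranspose_smul, hA.isHermitian.eq] using h
  have hleft (V : Matrix (Fin m) (Fin n) ℂ) :
      (σ : ℂ) ^ 2 * (U * Gᴴ * Vᴴ).trace = (Wstar * A * Vᴴ).trace := by
    rw [hBA, smul_mul, trace_smul, smul_eq_mul]
  have hright (V : Matrix (Fin m) (Fin n) ℂ) :
      (σ : ℂ) ^ 2 * (V * G * Uᴴ).trace = (V * A * Wstarᴴ).trace := by
    rw [Matrix.mul_assoc V A, hAB, Matrix.mul_smul, trace_smul, smul_eq_mul, Matrix.mul_assoc]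
  intro W
  have hdiff : f W - f Wstar = ((W - Wstar) * A * (W - Wstar)ᴴ).trace.re := by
    rw [hf, hf, hleft, hright, hleft, hright, ← Complex.sub_re]
    congr 1
    simp only [conjTranspose_sub, Matrix.sub_mul, Matrix.mul_sub, trace_sub]
    ring
  have htr := (hA.posSemidef.mul_mul_conjTranspose_same (W - Wstar)).trace_nonneg
  obtain ⟨hre, him⟩ := Complex.nonneg_iff.mp htr
  refine ⟨hdiff, hre, by linarith, fun heq => sub_eq_zero.mp ?_⟩
  refine hA.eq_zero_of_trace_mul_mul_conjTranspose_eq_zero (Complex.ext ?_ him.symm)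
  rw [← hdiff, heq, sub_self, Complex.zero_re]
end

section
/- Let σ > 0 be real, let B ∈ Matrix (Fin n) (Fin n) ℂ be Hermitian positive definite, let G ∈ Matrix (Fin n) (Fin m) ℂ and U ∈ Matrix (Fin m) (Fin m) ℂ, and set A := σ²·G·G^H + B. Define f : Matrix (Fin m) (Fin n) ℂ → ℝ by f(W) = (tr(W·A·W^H) − σ²·tr(U·G^H·W^H) − σ²·tr(W·G·U^H) + σ²·tr(U·U^H)).re. Then the minimum of f over all W is attained at W* := σ²·U·G^H·A⁻¹, and this minimum value equals (tr(U·(σ⁻²·1 + G^H·B⁻¹·G)⁻¹·U^H)).re. -/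
open Matrix
open scoped ComplexOrder

/-- Woodbury-type identity: if `A = s G Gᴴ + B`, then
`(s⁻¹ I + Gᴴ B⁻¹ G)⁻¹ = s I - s² Gᴴ A⁻¹ G`. -/
theorem inv_smul_one_add_conjTranspose_mul_inv_mul {m n : ℕ} {s : ℂ} (hs : s ≠ 0)
    {A B : Matrix (Fin n) (Fin n) ℂ} {G : Matrix (Fin n) (Fin m) ℂ}
    (hAu : IsUnit A.det) (hBu : IsUnit B.det) (hA : A = s • (G * Gᴴ) + B) :
    (s⁻¹ • (1 : Matrix (Fin m) (Fin m) ℂ) + Gᴴ * B⁻¹ * G)⁻¹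
      = s • (1 : Matrix (Fin m) (Fin m) ℂ) - s ^ 2 • (Gᴴ * A⁻¹ * G) := by
  apply Matrix.inv_eq_right_inv
  have hG : s • (G * Gᴴ) = A - B := by rw [hA, add_sub_cancel_right]
  have key : s • (Gᴴ * B⁻¹ * G * (Gᴴ * A⁻¹ * G)) = Gᴴ * B⁻¹ * G - Gᴴ * A⁻¹ * G := by
    calc s • (Gᴴ * B⁻¹ * G * (Gᴴ * A⁻¹ * G))
        = Gᴴ * (B⁻¹ * (s • (G * Gᴴ)) * A⁻¹) * G := by
          simp only [Matrix.mul_assoc, Matrix.mul_smul, Matrix.smul_mul]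
      _ = Gᴴ * B⁻¹ * G - Gᴴ * A⁻¹ * G := by
          rw [hG, Matrix.mul_sub, Matrix.nonsing_inv_mul B hBu, Matrix.sub_mul,
            Matrix.mul_assoc B⁻¹ A, Matrix.mul_nonsing_inv A hAu, Matrix.mul_one, Matrix.one_mul,
            Matrix.mul_sub, Matrix.sub_mul]
  have hsq : s ^ 2 • (Gᴴ * B⁻¹ * G * (Gᴴ * A⁻¹ * G))
      = s • (Gᴴ * B⁻¹ * G) - s • (Gᴴ * A⁻¹ * G) := by
    rw [sq, mul_smul, key, smul_sub]
  have hcancel : s ^ 2 * s⁻¹ = s := by field_simp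
  rw [Matrix.add_mul, Matrix.mul_sub, Matrix.mul_sub, Matrix.mul_smul (Gᴴ * B⁻¹ * G) (s ^ 2), hsq]
  simp only [Matrix.smul_mul, Matrix.mul_smul, Matrix.one_mul, Matrix.mul_one, smul_smul,
    hcancel, mul_inv_cancel₀ hs, one_smul]
  abel

/-- Completing the square in the matrix-valued mean-squared error. -/
theorem quadratic_eq_square_add {m n : ℕ} {s : ℂ} (hs : star s = s)
    {A : Matrix (Fin n) (Fin n) ℂ} (hAu : IsUnit A.det) (hAh : A.IsHermitian)
    (G : Matrix (Fin n) (Fin m) ℂ) (U : Matrix (Fin m) (Fin m) ℂ) (W : Matrix (Fin m) (Fin n) ℂ) :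
    W * A * Wᴴ - s • (U * Gᴴ * Wᴴ) - s • (W * G * Uᴴ) + s • (U * Uᴴ)
      = (W - s • (U * Gᴴ * A⁻¹)) * A * (W - s • (U * Gᴴ * A⁻¹))ᴴ
        + U * (s • (1 : Matrix (Fin m) (Fin m) ℂ) - s ^ 2 • (Gᴴ * A⁻¹ * G)) * Uᴴ := by
  set V := s • (U * Gᴴ * A⁻¹) with hV
  have hVA : V * A = s • (U * Gᴴ) := by
    rw [hV, Matrix.smul_mul, Matrix.mul_assoc, Matrix.nonsing_inv_mul A hAu, Matrix.mul_one]
  have hVH : Vᴴ = s • (A⁻¹ * G * Uᴴ) := by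
    rw [hV, conjTranspose_smul, hs, conjTranspose_mul, conjTranspose_mul,
      conjTranspose_conjTranspose, hAh.inv.eq, Matrix.mul_assoc]
  have hAV : A * Vᴴ = s • (G * Uᴴ) := by
    rw [hVH, Matrix.mul_smul, Matrix.mul_assoc, ← Matrix.mul_assoc, Matrix.mul_nonsing_inv A hAu,
      Matrix.one_mul]
  have hWV : W * A * Vᴴ = s • (W * G * Uᴴ) := by
    rw [Matrix.mul_assoc, hAV, Matrix.mul_smul, Matrix.mul_assoc]
  have hVV : s • (U * Gᴴ) * Vᴴ = s ^ 2 • (U * (Gᴴ * A⁻¹ * G) * Uᴴ) := by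
    rw [hVH]
    simp only [Matrix.smul_mul, Matrix.mul_smul, smul_smul, sq, Matrix.mul_assoc]
  rw [conjTranspose_sub, Matrix.sub_mul, Matrix.mul_sub, Matrix.sub_mul, Matrix.sub_mul, hVA, hWV,
    hVV, Matrix.mul_sub, Matrix.sub_mul]
  simp only [Matrix.smul_mul, Matrix.mul_smul, Matrix.mul_one]
  abel

/-- Eqs. (22)–(23) of the paper: with `A = σ² G Gᴴ + B`, the quadratic MSE functional
`f(W) = re(tr(W A Wᴴ) − σ² tr(U Gᴴ Wᴴ) − σ² tr(W G Uᴴ) + σ² tr(U Uᴴ))`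
attains its minimum at the MMSE receiver `W* = σ² U Gᴴ A⁻¹`, and the minimum
value equals `re tr(U (σ⁻² I + Gᴴ B⁻¹ G)⁻¹ Uᴴ)`. -/
theorem mmse_minimum_value
    {m n : ℕ} (σ : ℝ) (hσ : 0 < σ)
    (B : Matrix (Fin n) (Fin n) ℂ) (hB : B.PosDef)
    (G : Matrix (Fin n) (Fin m) ℂ) (U : Matrix (Fin m) (Fin m) ℂ)
    (A : Matrix (Fin n) (Fin n) ℂ)
    (hA : A = (σ : ℂ) ^ 2 • (G * Gᴴ) + B)
    (f : Matrix (Fin m) (Fin n) ℂ → ℝ)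
    (hf : ∀ W, f W =
      ((W * A * Wᴴ).trace - (σ : ℂ) ^ 2 * (U * Gᴴ * Wᴴ).trace
        - (σ : ℂ) ^ 2 * (W * G * Uᴴ).trace + (σ : ℂ) ^ 2 * (U * Uᴴ).trace).re)
    (Wstar : Matrix (Fin m) (Fin n) ℂ)
    (hWstar : Wstar = ((σ : ℂ) ^ 2) • (U * Gᴴ * A⁻¹)) :
    (∀ W : Matrix (Fin m) (Fin n) ℂ, f Wstar ≤ f W) ∧
    f Wstar = ((U * (((σ : ℂ) ^ 2)⁻¹ • (1 : Matrix (Fin m) (Fin m) ℂ)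
        + Gᴴ * B⁻¹ * G)⁻¹ * Uᴴ).trace).re := by
  have hs0 : (σ : ℂ) ^ 2 ≠ 0 := pow_ne_zero 2 (Complex.ofReal_ne_zero.mpr hσ.ne')
  have hstar : star ((σ : ℂ) ^ 2) = (σ : ℂ) ^ 2 := by
    rw [star_pow]
    simp
  have hs_nonneg : (0 : ℂ) ≤ (σ : ℂ) ^ 2 := by
    exact_mod_cast sq_nonneg σ
  have hApos : A.PosDef := by
    rw [hA]
    exact PosDef.posSemidef_add ((posSemidef_self_mul_conjTranspose G).smul hs_nonneg) hB
  have hAu : IsUnit A.det := (Matrix.isUnit_iff_isUnit_det A).mp hApos.isUnit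
  have hBu : IsUnit B.det := (Matrix.isUnit_iff_isUnit_det B).mp hB.isUnit
  have hdecomp : ∀ W, f W = ((W - Wstar) * A * (W - Wstar)ᴴ).trace.re
      + (U * (((σ : ℂ) ^ 2)⁻¹ • (1 : Matrix (Fin m) (Fin m) ℂ)
        + Gᴴ * B⁻¹ * G)⁻¹ * Uᴴ).trace.re := by
    intro W
    rw [inv_smul_one_add_conjTranspose_mul_inv_mul hs0 hAu hBu hA, ← Complex.add_re,
      ← Matrix.trace_add, hWstar, ← quadratic_eq_square_add hstar hAu hApos.isHermitian, hf]
    simp only [Matrix.trace_add, Matrix.trace_sub, Matrix.trace_smul, smul_eq_mul]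
  have hmin : f Wstar = (U * (((σ : ℂ) ^ 2)⁻¹ • (1 : Matrix (Fin m) (Fin m) ℂ)
      + Gᴴ * B⁻¹ * G)⁻¹ * Uᴴ).trace.re := by
    rw [hdecomp, sub_self, Matrix.zero_mul, Matrix.zero_mul, Matrix.trace_zero, Complex.zero_re,
      zero_add]
  refine ⟨fun W => ?_, hmin⟩
  rw [hmin, hdecomp W]
  exact le_add_of_nonneg_left
    (Complex.le_def.mp (hApos.posSemidef.mul_mul_conjTranspose_same (W - Wstar)).trace_nonneg).1
end

section
/- Let d : Fin n → ℝ with d_i > 0 for all i, let D ∈ Matrix (Fin n) (Fin n) ℂ be the diagonal matrix with entries (d_i : ℂ), and let S ∈ Matrix (Fin n) (Fin n) ℂ satisfy S^H · S = D⁻¹. Suppose S = Q · Ũ · Φ^H where Q and Φ are unitary (members of Matrix.unitaryGroup) and Ũ is upper triangular with every diagonal entry equal to a real σ̄ > 0. Then σ̄^(2n) · ∏ i, d i = 1, i.e. σ̄² = (∏ i, d i)^(−1/n). -/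
open Matrix

theorem Matrix.star_det_mul_det_of_mem_unitaryGroup {n α : Type*} [Fintype n] [DecidableEq n]
    [CommRing α] [StarRing α] {U : Matrix n n α} (hU : U ∈ Matrix.unitaryGroup n α) :
    star U.det * U.det = 1 := by
  rw [← Matrix.det_conjTranspose, ← Matrix.det_mul, ← Matrix.star_eq_conjTranspose,
    Matrix.mem_unitaryGroup_iff'.mp hU, Matrix.det_one]

/-- Eq. (42) of the paper: if `Sᴴ S = D⁻¹` with `D = diag(d₁, …, dₙ)` (`dᵢ > 0`) and
`S = Q Ũ Φᴴ` is a geometric mean decomposition (`Q`, `Φ` unitary, `Ũ` upper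
triangular with all diagonal entries equal to `σ̄ > 0`), then
`σ̄^(2n) ∏ dᵢ = 1`, i.e. `σ̄²` is the geometric mean of the `dᵢ⁻¹`. -/
theorem gmd_diagonal_value
    {n : ℕ} (d : Fin n → ℝ) (hd : ∀ i, 0 < d i)
    (S Q Φ Ut : Matrix (Fin n) (Fin n) ℂ)
    (hQ : Q ∈ Matrix.unitaryGroup (Fin n) ℂ)
    (hΦ : Φ ∈ Matrix.unitaryGroup (Fin n) ℂ)
    (sbar : ℝ) (hsbar : 0 < sbar)
    (hS : Sᴴ * S = (Matrix.diagonal fun i => (d i : ℂ))⁻¹)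
    (hdecomp : S = Q * Ut * Φᴴ)
    (hUpper : ∀ i j : Fin n, j < i → Ut i j = 0)
    (hDiag : ∀ i : Fin n, Ut i i = (sbar : ℂ)) :
    sbar ^ (2 * n) * ∏ i, d i = 1 := by
  have hUdet : Ut.det = (sbar : ℂ) ^ n := by
    rw [Matrix.det_of_isUpperTriangular fun i j hij => hUpper i j hij]
    simp [hDiag]
  have hQdet := Matrix.star_det_mul_det_of_mem_unitaryGroup hQ
  have hΦdet := Matrix.star_det_mul_det_of_mem_unitaryGroup hΦ
  have hDdet : (∏ i, (d i : ℂ)) ≠ 0 :=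
    Finset.prod_ne_zero_iff.mpr fun i _ => Complex.ofReal_ne_zero.mpr (hd i).ne'
  have hdet : star S.det * S.det = (∏ i, (d i : ℂ))⁻¹ := by
    rw [← Matrix.det_conjTranspose, ← Matrix.det_mul, hS, Matrix.det_nonsing_inv,
      Matrix.det_diagonal, Ring.inverse_eq_inv']
  have hSdet : star S.det * S.det = (sbar : ℂ) ^ (2 * n) := by
    rw [hdecomp, Matrix.det_mul, Matrix.det_mul, Matrix.det_conjTranspose, hUdet]
    have hstar : star ((sbar : ℂ) ^ n) = (sbar : ℂ) ^ n := by simp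
    simp only [star_mul', star_star, hstar]
    linear_combination (sbar : ℂ) ^ (2 * n) * star Φ.det * Φ.det * hQdet +
      (sbar : ℂ) ^ (2 * n) * hΦdet
  have h : (sbar : ℂ) ^ (2 * n) * ∏ i, (d i : ℂ) = 1 := by
    rw [← hSdet, hdet, inv_mul_cancel₀ hDdet]
  exact_mod_cast h
end

section
/- Let λ₁, λ₂, x, μ be positive reals satisfying λ₁²·x·λ₂²·μ ≥ λ₁²·x + 1. Define y := (Real.sqrt (λ₁⁴·x² + 4·λ₁²·x·λ₂²·μ) − λ₁²·x − 2) / (2·λ₂²). Then y ≥ 0 and (λ₂²·y + λ₁²·x + 1)·(λ₂²·y + 1) = μ·λ₁²·x·λ₂². In particular y satisfies the KKT stationarity condition λ₂²·λ₁²·x·(λ₁²·x+1) / ((λ₂²·y + λ₁²·x + 1)·(λ₂²·y·λ₁²·x + λ₂²·y + λ₁²·x + 1)) = 1/μ. -/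
/-- Eq. (39) of the paper: in the iterative water-filling solution of the
power-allocation problem, for given `x` and water level `μ` with
`λ₁² x λ₂² μ ≥ λ₁² x + 1`, the closed-form
`y = (√(λ₁⁴ x² + 4 λ₁² x λ₂² μ) − λ₁² x − 2) / (2 λ₂²)` is nonnegative, solves the
quadratic equation `(λ₂² y + λ₁² x + 1)(λ₂² y + 1) = μ λ₁² x λ₂²`, and satisfies the
KKT stationarity condition. -/
theorem waterfilling_relay_power
    (l₁ l₂ x μ : ℝ) (hl₁ : 0 < l₁) (hl₂ : 0 < l₂) (hx : 0 < x) (hμ : 0 < μ)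
    (h : l₁ ^ 2 * x + 1 ≤ l₁ ^ 2 * x * l₂ ^ 2 * μ)
    (y : ℝ)
    (hy : y = (Real.sqrt (l₁ ^ 4 * x ^ 2 + 4 * l₁ ^ 2 * x * l₂ ^ 2 * μ)
        - l₁ ^ 2 * x - 2) / (2 * l₂ ^ 2)) :
    0 ≤ y ∧
    (l₂ ^ 2 * y + l₁ ^ 2 * x + 1) * (l₂ ^ 2 * y + 1) = μ * l₁ ^ 2 * x * l₂ ^ 2 ∧
    l₂ ^ 2 * l₁ ^ 2 * x * (l₁ ^ 2 * x + 1)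
        / ((l₂ ^ 2 * y + l₁ ^ 2 * x + 1)
            * (l₂ ^ 2 * y * l₁ ^ 2 * x + l₂ ^ 2 * y + l₁ ^ 2 * x + 1)) = 1 / μ := by
  set S := Real.sqrt (l₁ ^ 4 * x ^ 2 + 4 * l₁ ^ 2 * x * l₂ ^ 2 * μ)
  have hS_sq : S ^ 2 = l₁ ^ 4 * x ^ 2 + 4 * l₁ ^ 2 * x * l₂ ^ 2 * μ :=
    Real.sq_sqrt (by positivity)
  have hS_le : l₁ ^ 2 * x + 2 ≤ S := Real.le_sqrt_of_sq_le (by linarith)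
  have hyS : S = 2 * (l₂ ^ 2 * y) + l₁ ^ 2 * x + 2 := by
    rw [hy]
    field_simp
    ring
  have hy0 : 0 ≤ y := by
    rw [hy]
    exact div_nonneg (by linarith) (by positivity)
  have hquad : (l₂ ^ 2 * y + l₁ ^ 2 * x + 1) * (l₂ ^ 2 * y + 1) = μ * l₁ ^ 2 * x * l₂ ^ 2 := by
    rw [hyS] at hS_sq
    linarith
  refine ⟨hy0, hquad, ?_⟩
  rw [div_eq_div_iff (by positivity) hμ.ne']
  linear_combination -(l₁ ^ 2 * x + 1) * hquad
end

section
/- Let λ₁, λ₂, x, μ, β₁, β₂ be positive reals satisfying β₂·(λ₁²·x + β₁) ≤ μ·λ₂²·λ₁²·x. Define y := (β₂/(2·λ₂²))·(Real.sqrt (λ₁⁴·x²/β₁² + 4·λ₁²·x·λ₂²·μ/(β₁·β₂)) − λ₁²·x/β₁ − 2). Then y ≥ 0 and (λ₂²·y + β₂)·(β₁·λ₂²·y + λ₁²·x·β₂ + β₁·β₂) = μ·λ₂²·λ₁²·x·β₂. -/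
/-- Eq. (61) of the paper (robust design with identity error covariance at the
receiver side): for given `x` and water level `μ` with
`β₂ (λ₁² x + β₁) ≤ μ λ₂² λ₁² x`, the closed-form
`y = (β₂/(2λ₂²)) (√(λ₁⁴ x²/β₁² + 4 λ₁² x λ₂² μ/(β₁ β₂)) − λ₁² x/β₁ − 2)` is
nonnegative and solves the quadratic stationarity equation
`(λ₂² y + β₂)(β₁ λ₂² y + λ₁² x β₂ + β₁ β₂) = μ λ₂² λ₁² x β₂`. -/
theorem waterfilling_relay_power_beta
    (l₁ l₂ x μ β₁ β₂ : ℝ)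
    (hl₁ : 0 < l₁) (hl₂ : 0 < l₂) (hx : 0 < x) (hμ : 0 < μ)
    (hβ₁ : 0 < β₁) (hβ₂ : 0 < β₂)
    (h : β₂ * (l₁ ^ 2 * x + β₁) ≤ μ * l₂ ^ 2 * l₁ ^ 2 * x)
    (y : ℝ)
    (hy : y = (β₂ / (2 * l₂ ^ 2))
        * (Real.sqrt (l₁ ^ 4 * x ^ 2 / β₁ ^ 2
              + 4 * l₁ ^ 2 * x * l₂ ^ 2 * μ / (β₁ * β₂))
            - l₁ ^ 2 * x / β₁ - 2)) :
    0 ≤ y ∧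
    (l₂ ^ 2 * y + β₂) * (β₁ * l₂ ^ 2 * y + l₁ ^ 2 * x * β₂ + β₁ * β₂)
      = μ * l₂ ^ 2 * l₁ ^ 2 * x * β₂ := by
  have hdisc : l₁ ^ 4 * x ^ 2 / β₁ ^ 2 + 4 * l₁ ^ 2 * x * l₂ ^ 2 * μ / (β₁ * β₂)
      = (l₁ ^ 2 * x / β₁) ^ 2 + 4 * (μ * l₂ ^ 2 * l₁ ^ 2 * x) / (β₁ * β₂) := by
    ring
  rw [hdisc] at hy
  have hsq := Real.sq_sqrt (show
    0 ≤ (l₁ ^ 2 * x / β₁) ^ 2 + 4 * (μ * l₂ ^ 2 * l₁ ^ 2 * x) / (β₁ * β₂) by positivity)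
  have hroot : l₁ ^ 2 * x / β₁ + 2 ≤ Real.sqrt
      ((l₁ ^ 2 * x / β₁) ^ 2 + 4 * (μ * l₂ ^ 2 * l₁ ^ 2 * x) / (β₁ * β₂)) := by
    apply Real.le_sqrt_of_sq_le
    have hlevel : 4 * (l₁ ^ 2 * x / β₁) + 4
        ≤ 4 * (μ * l₂ ^ 2 * l₁ ^ 2 * x) / (β₁ * β₂) := by
      rw [le_div_iff₀ (by positivity)]
      have hclear : (4 * (l₁ ^ 2 * x / β₁) + 4) * (β₁ * β₂)
          = 4 * (β₂ * (l₁ ^ 2 * x + β₁)) := by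
        field_simp
      linarith
    linarith
  generalize Real.sqrt
    ((l₁ ^ 2 * x / β₁) ^ 2 + 4 * (μ * l₂ ^ 2 * l₁ ^ 2 * x) / (β₁ * β₂)) = s at hy hsq hroot
  refine ⟨hy ▸ mul_nonneg (by positivity) (by linarith), ?_⟩
  have hfirst : l₂ ^ 2 * y + β₂ = β₂ / 2 * (s - l₁ ^ 2 * x / β₁) := by
    rw [hy]
    field_simp
    ring
  have hsecond : β₁ * l₂ ^ 2 * y + l₁ ^ 2 * x * β₂ + β₁ * β₂
      = β₁ * β₂ / 2 * (s + l₁ ^ 2 * x / β₁) := by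
    rw [hy]
    field_simp
    ring
  calc (l₂ ^ 2 * y + β₂) * (β₁ * l₂ ^ 2 * y + l₁ ^ 2 * x * β₂ + β₁ * β₂)
      = β₁ * β₂ ^ 2 / 4 * (s ^ 2 - (l₁ ^ 2 * x / β₁) ^ 2) := by
        rw [hfirst, hsecond]
        ring
    _ = μ * l₂ ^ 2 * l₁ ^ 2 * x * β₂ := by
        rw [hsq, add_sub_cancel_left]
        field_simp
end
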